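/- Let p ≠ q be odd primes, k ≥ 1, and let s be the largest integer such that q^s divides p^{2[q|p]} − 1. Let B be a p^k-form of rank 2[q|p] with ε(B) = η(q). Then for every integer ℓ with 1 ≤ ℓ ≤ s, there exists an isometry of B of order exactly q^ℓ which has no non-zero fixed points. -/

import Mathlib

open Matrix

/-- `minExp p q` is the least positive integer `a` such that `q ∣ p^a - 1` or `q ∣ p^a + 1`.
(This is denoted `[q|p]` in the paper.) -/
noncomputable def minExp (p q : ℕ) : ℕ :=
  sInf {a : ℕ | 0 < a ∧ (q ∣ p ^ a - 1 ∨ q ∣ p ^ a + 1)}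

/-- `eta p q` is `1` if `q ∣ p^[q|p] - 1` and `-1` otherwise. -/
noncomputable def eta (p q : ℕ) : ℤ :=
  if q ∣ p ^ minExp p q - 1 then 1 else -1

open Classical in
/-- The index `ε(B)` of a symmetric bilinear form `B` over `ℤ/p^kℤ`:
`ε₁ · ε₂`, where `ε₁ = 1` iff `det B` is a square, and
`ε₂ = -1` iff `p ≡ 3 (mod 4)` and the rank is `≡ 2 (mod 4)`. -/
noncomputable def epsilon (p : ℕ) {ι : Type*} [Fintype ι] [DecidableEq ι] {R : Type*}
    [CommRing R] (B : Matrix ι ι R) : ℤ :=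
  (if IsSquare B.det then 1 else -1) *
    (if p % 4 = 3 ∧ Fintype.card ι % 4 = 2 then -1 else 1)


def Good {ι R : Type*} [Fintype ι] [DecidableEq ι] [CommRing R] (q l : ℕ) (B : Matrix ι ι R) :
    Prop :=
  ∃ A : Matrix ι ι R, Aᵀ * B * A = B ∧ A ^ (q ^ l) = 1 ∧ IsUnit (A ^ (q ^ (l - 1)) - 1).det

theorem one_add_pow_eq_one {S : Type*} [Ring S] (p k : ℕ) (hk : 1 ≤ k) (h0 : (p : S) ^ k = 0)
    (x M : S) (hx : x = 1 + p * M) : x ^ p ^ (k - 1) = 1 := by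
  open Polynomial in
  have h := dvd_sub_pow_of_dvd_sub (R := ℤ[X]) (p := p) (a := 1 + (p : ℤ[X]) * X) (b := 1) (by simp) (k - 1)
  rw [Nat.sub_add_cancel hk] at h
  obtain ⟨c, hc⟩ := h
  have := congrArg (Polynomial.aeval M) hc
  simp [h0] at this
  rw [hx]
  exact sub_eq_zero.mp this

/-- transport along congruence -/
theorem Good.congr {ι R : Type*} [Fintype ι] [DecidableEq ι] [CommRing R] {q l : ℕ}
    {B C : Matrix ι ι R} (h : Good q l B) (P : Matrix ι ι R) (hP : IsUnit P.det)
    (hC : Pᵀ * B * P = C) : Good q l C := by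
  obtain ⟨A, h1, h2, h3⟩ := h
  have hi : P * P⁻¹ = 1 := Matrix.mul_nonsing_inv P hP
  have hi' : P⁻¹ * P = 1 := Matrix.nonsing_inv_mul P hP
  have hpow : ∀ m : ℕ, (P⁻¹ * A * P) ^ m = P⁻¹ * A ^ m * P := by
    intro m
    induction m with
    | zero => simp [hi']
    | succ m ih =>
      rw [pow_succ, ih, pow_succ]
      calc P⁻¹ * A ^ m * P * (P⁻¹ * A * P) = P⁻¹ * A ^ m * (P * P⁻¹) * A * P := by noncomm_ring
        _ = _ := by rw [hi]; noncomm_ring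
  refine ⟨P⁻¹ * A * P, ?_, ?_, ?_⟩
  · rw [← hC]
    have hit : (P⁻¹)ᵀ * Pᵀ = 1 := by rw [← transpose_mul, hi, transpose_one]
    rw [transpose_mul, transpose_mul]
    calc Pᵀ * (Aᵀ * P⁻¹ᵀ) * (Pᵀ * B * P) * (P⁻¹ * A * P)
        = Pᵀ * Aᵀ * (P⁻¹ᵀ * Pᵀ) * B * (P * P⁻¹) * A * P := by noncomm_ring
      _ = Pᵀ * (Aᵀ * B * A) * P := by rw [hi, hit]; noncomm_ring
      _ = _ := by rw [h1]
  · rw [hpow, h2]; simp [hi']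
  · rw [hpow]
    have : P⁻¹ * A ^ q ^ (l - 1) * P - 1 = P⁻¹ * (A ^ q ^ (l - 1) - 1) * P := by
      rw [mul_sub, sub_mul]; simp [hi']
    rw [this, det_mul, det_mul, mul_right_comm, ← det_mul, hi']
    simpa using h3

theorem Good.reindex {ι κ R : Type*} [Fintype ι] [DecidableEq ι] [Fintype κ] [DecidableEq κ]
    [CommRing R] {q l : ℕ}
    {B : Matrix ι ι R} (h : Good q l B) (e : ι ≃ κ) : Good q l (Matrix.reindex e e B) := by
  obtain ⟨A, h1, h2, h3⟩ := h
  refine ⟨Matrix.reindexAlgEquiv R R e A, ?_, ?_, ?_⟩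
  · have : (Matrix.reindexAlgEquiv R R e A)ᵀ = Matrix.reindexAlgEquiv R R e Aᵀ := rfl
    rw [this]
    have h4 : Matrix.reindex e e B = Matrix.reindexAlgEquiv R R e B := rfl
    rw [h4, ← map_mul, ← map_mul, h1]
  · rw [← map_pow, h2, map_one]
  · rw [← map_pow, ← map_one (Matrix.reindexAlgEquiv R R e), ← map_sub,
      Matrix.det_reindexAlgEquiv]
    exact h3

theorem Good.final {ι R : Type*} [Fintype ι] [DecidableEq ι] [Nonempty ι] [CommRing R]
    [Nontrivial R] {q l : ℕ}
    (hq : q.Prime) (hl : 1 ≤ l) {B : Matrix ι ι R} (h : Good q l B) :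
    ∃ A : Matrix ι ι R, Aᵀ * B * A = B ∧ orderOf A = q ^ l ∧
        ∀ x : ι → R, A.mulVec x = x → x = 0 := by
  obtain ⟨A, h1, h2, h3⟩ := h
  refine ⟨A, h1, ?_, ?_⟩
  · have : Fact q.Prime := ⟨hq⟩
    have := orderOf_eq_prime_pow (x := A) (p := q) (n := l - 1) (by
      intro hh
      rw [hh, sub_self, det_zero] at h3
      exact not_isUnit_zero h3) (by rwa [Nat.sub_add_cancel hl])
    rwa [Nat.sub_add_cancel hl] at this
  · intro x hx
    have hm : ∀ m : ℕ, (A ^ m).mulVec x = x := by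
      intro m
      induction m with
      | zero => simp
      | succ m ih => rw [pow_succ, ← mulVec_mulVec, hx, ih]
    have h4 : (A ^ q ^ (l - 1) - 1).mulVec x = 0 := by
      rw [sub_mulVec, hm]; simp
    have h5 := congrArg ((A ^ q ^ (l - 1) - 1)⁻¹).mulVec h4
    rwa [mulVec_mulVec, nonsing_inv_mul _ h3, one_mulVec, mulVec_zero] at h5

section lift
variable {p k : ℕ}

theorem pk_zero {ι : Type*} [Fintype ι] [DecidableEq ι] :
    ((p : Matrix ι ι (ZMod (p ^ k))) ^ k) = 0 := by
  have : ((p ^ k : ℕ) : Matrix ι ι (ZMod (p ^ k))) = 0 := by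
    ext i j
    rw [← Matrix.diagonal_natCast]
    simp [Matrix.diagonal_apply]
  exact_mod_cast this

theorem pk_zero' : ((p : (ZMod (p ^ k))) ^ k) = 0 := by
  exact_mod_cast ZMod.natCast_self (p ^ k)

abbrev redHom (p k : ℕ) (hk : 1 ≤ k) : ZMod (p ^ k) →+* ZMod p :=
  ZMod.castHom (dvd_pow_self p (by omega)) (ZMod p)

theorem red_ker (hp : p.Prime) (hk : 1 ≤ k) (x : ZMod (p ^ k)) (hx : redHom p k hk x = 0) :
    ∃ y, x = p * y := by
  have : NeZero (p ^ k) := ⟨pow_ne_zero _ hp.ne_zero⟩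
  obtain ⟨m, rfl⟩ := ZMod.natCast_zmod_surjective x
  rw [map_natCast, ZMod.natCast_eq_zero_iff] at hx
  obtain ⟨c, rfl⟩ := hx
  exact ⟨c, by push_cast; rfl⟩

theorem red_ker_mat (hp : p.Prime) (hk : 1 ≤ k) {ι : Type*} [Fintype ι] [DecidableEq ι]
    (X : Matrix ι ι (ZMod (p ^ k)))
    (hX : (redHom p k hk).mapMatrix X = 1) : ∃ Y, X = 1 + p * Y := by
  have : ∀ i j, ∃ y, (X - 1) i j = p * y := by
    intro i j
    apply red_ker hp hk
    have : (redHom p k hk).mapMatrix (X - 1) = 0 := by rw [map_sub, hX, map_one, sub_self]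
    exact congrFun (congrFun this i) j
  choose Y hY using this
  refine ⟨Matrix.of Y, ?_⟩
  rw [← sub_eq_iff_eq_add']
  ext i j
  rw [hY, ← Matrix.diagonal_natCast, Matrix.diagonal_mul]
  rfl

theorem red_isUnit (hp : p.Prime) (hk : 1 ≤ k) (x : ZMod (p ^ k))
    (hx : IsUnit (redHom p k hk x)) : IsUnit x := by
  obtain ⟨y, hy⟩ := ZMod.castHom_surjective (dvd_pow_self p (by omega : k ≠ 0))
    (↑hx.unit⁻¹ : ZMod p)
  have h1 : redHom p k hk (x * y - 1) = 0 := by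
    rw [map_sub, map_mul, map_one]
    change _ * (ZMod.castHom _ _ y) - _ = _
    rw [hy, IsUnit.mul_val_inv, sub_self]
  obtain ⟨z, hz⟩ := red_ker hp hk _ h1
  have h2 := one_add_pow_eq_one p k hk pk_zero' (x * y) z (by rw [← hz]; ring)
  have h3 : IsUnit ((x * y) ^ p ^ (k - 1)) := by rw [h2]; exact isUnit_one
  rw [isUnit_pow_iff (pow_ne_zero _ hp.ne_zero)] at h3
  exact isUnit_of_mul_isUnit_left h3

theorem red_isSquare (hp : p.Prime) (hp2 : p ≠ 2) (hk : 1 ≤ k) (x : ZMod (p ^ k)) (hx : IsUnit x)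
    : IsSquare x ↔ IsSquare (redHom p k hk x) := by
  refine ⟨fun h => h.map _, ?_⟩
  rintro ⟨r, hr⟩
  obtain ⟨y, rfl⟩ := ZMod.castHom_surjective (dvd_pow_self p (by omega : k ≠ 0)) r
  have hy : IsUnit y := by
    apply red_isUnit hp hk
    have := hx.map (redHom p k hk)
    rw [hr] at this
    exact isUnit_of_mul_isUnit_left this
  obtain ⟨u, rfl⟩ := hy
  have h1 : redHom p k hk (x * (↑u⁻¹ * ↑u⁻¹) - 1) = 0 := by
    rw [map_sub, map_mul, hr]
    change (redHom p k hk) _ * (redHom p k hk) _ * _ - _ = _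
    rw [← map_mul, ← map_mul, ← map_sub]
    have : (u : ZMod (p ^ k)) * u * (↑u⁻¹ * ↑u⁻¹) - 1 = 0 := by
      rw [mul_assoc, Units.mul_inv_cancel_left]; simp
    rw [this, map_zero]
  obtain ⟨z, hz⟩ := red_ker hp hk _ h1
  have h2 := one_add_pow_eq_one p k hk pk_zero' (x * (↑u⁻¹ * ↑u⁻¹)) z (by rw [← hz]; ring)
  obtain ⟨m, hm⟩ := (hp.odd_of_ne_two hp2).pow (n := k - 1)
  have h3 : x = (x * (↑u⁻¹ * ↑u⁻¹)) * (x * (↑u⁻¹ * ↑u⁻¹)) ^ p ^ (k - 1) * (u * u) := by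
    rw [h2]
    simp [mul_assoc]
  rw [hm] at h3
  refine ⟨(x * (↑u⁻¹ * ↑u⁻¹)) ^ (m + 1) * u, ?_⟩
  calc x = _ := h3
    _ = _ := by ring

theorem Good.lift (hp : p.Prime) (hp2 : p ≠ 2) (hk : 1 ≤ k) {ι : Type*} [Fintype ι]
    [DecidableEq ι] {q l : ℕ}
    (B : Matrix ι ι (ZMod (p ^ k))) (hB : B.IsSymm) (hdet : IsUnit B.det)
    (h : Good q l ((redHom p k hk).mapMatrix B)) : Good q l B := by
  have : Fact p.Prime := ⟨hp⟩
  obtain ⟨A, h1, h2, h3⟩ := h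
  have hsurj : ∃ A', (redHom p k hk).mapMatrix A' = A := by
    choose f hf using ZMod.castHom_surjective (dvd_pow_self p (by omega : k ≠ 0))
    exact ⟨A.map f, by ext i j; simp [hf]⟩
  obtain ⟨A₀, rfl⟩ := hsurj
  set f := (redHom p k hk).mapMatrix (m := ι) with hf
  have hft : ∀ X, f Xᵀ = (f X)ᵀ := fun X => rfl
  -- C = A₀ᵀ B A₀
  set C := A₀ᵀ * B * A₀ with hC
  have hfC : f C = f B := by rw [hC, map_mul, map_mul, hft, h1]
  have hCs : Cᵀ = C := by
    rw [hC, transpose_mul, transpose_mul, transpose_transpose, hB.eq, mul_assoc]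
  have hCdet : IsUnit C.det := by
    apply red_isUnit hp hk
    have := hdet.map (redHom p k hk)
    rw [RingHom.map_det] at this ⊢
    rwa [← hf, hfC]
  set T := C⁻¹ * B with hT
  have hCT : C * T = B := by rw [hT, ← mul_assoc, mul_nonsing_inv _ hCdet, one_mul]
  have hTC : Tᵀ * C = C * T := by
    rw [hCT, ← hCs, ← transpose_mul, hCT, hB.eq]
  have hfT : f T = 1 := by
    rw [hT, map_mul, ← hfC, ← map_mul, nonsing_inv_mul _ hCdet, map_one]
  obtain ⟨Y, hY⟩ := red_ker_mat hp hk T hfT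
  have hT1 := one_add_pow_eq_one p k hk pk_zero T Y hY
  obtain ⟨m, hm⟩ := (hp.odd_of_ne_two hp2).pow (n := k - 1)
  have hTm : ∀ j : ℕ, (T ^ j)ᵀ * C = C * T ^ j := by
    intro j
    induction j with
    | zero => simp
    | succ j ih =>
      rw [pow_succ, transpose_mul, mul_assoc, ih, ← mul_assoc, hTC, mul_assoc, ← pow_succ',
        pow_succ]
  set A₁ := A₀ * T ^ (m + 1) with hA₁
  have hA₁B : A₁ᵀ * B * A₁ = B := by
    calc A₁ᵀ * B * A₁ = (T ^ (m + 1))ᵀ * C * T ^ (m + 1) := by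
          rw [hA₁, transpose_mul, hC]; noncomm_ring
      _ = C * (T ^ p ^ (k - 1) * T) := by
          rw [hTm, mul_assoc, ← pow_add, hm, ← pow_succ]; congr 2; ring
      _ = B := by rw [hT1, one_mul, hCT]
  have hfA₁ : f A₁ = f A₀ := by rw [hA₁, map_mul, map_pow, hfT, one_pow, mul_one]
  have hiso : ∀ j : ℕ, (A₁ ^ j)ᵀ * B * A₁ ^ j = B := by
    intro j
    induction j with
    | zero => simp
    | succ j ih =>
      calc (A₁ ^ (j + 1))ᵀ * B * A₁ ^ (j + 1) = A₁ᵀ * ((A₁ ^ j)ᵀ * B * A₁ ^ j) * A₁ := by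
            rw [pow_succ, transpose_mul]; noncomm_ring
        _ = B := by rw [ih, hA₁B]
  refine ⟨A₁ ^ p ^ (k - 1), hiso _, ?_, ?_⟩
  · rw [← pow_mul, mul_comm, pow_mul]
    have : f (A₁ ^ q ^ l) = 1 := by rw [map_pow, hfA₁, h2]
    obtain ⟨Z, hZ⟩ := red_ker_mat hp hk _ this
    exact one_add_pow_eq_one p k hk pk_zero _ Z hZ
  · apply red_isUnit hp hk
    rw [RingHom.map_det, ← hf, map_sub, map_pow, map_pow, hfA₁, map_one, ← pow_mul, mul_comm,
      pow_mul]
    cases isEmpty_or_nonempty ι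
    · simp
    have := sub_pow_char_pow_of_commute (x := f A₀ ^ q ^ (l - 1)) (y := 1) p (k - 1)
      (Commute.one_right _)
    rw [one_pow] at this
    rw [← this, det_pow]
    exact h3.pow _

end lift

section classify
variable {F : Type*} [Field F] {ι : Type*} [Fintype ι] [DecidableEq ι]

/-- congruence -/
def MCong (B C : Matrix ι ι F) : Prop := ∃ P : Matrix ι ι F, IsUnit P.det ∧ Pᵀ * B * P = C

theorem MCong.refl (B : Matrix ι ι F) : MCong B B := ⟨1, by simp, by simp⟩

theorem MCong.trans {B C D : Matrix ι ι F} (h : MCong B C) (h' : MCong C D) : MCong B D := by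
  obtain ⟨P, hP, rfl⟩ := h
  obtain ⟨Q, hQ, rfl⟩ := h'
  exact ⟨P * Q, by rw [det_mul]; exact hP.mul hQ, by rw [transpose_mul]; noncomm_ring⟩

theorem MCong.symm {B C : Matrix ι ι F} (h : MCong B C) : MCong C B := by
  obtain ⟨P, hP, rfl⟩ := h
  refine ⟨P⁻¹, ?_, ?_⟩
  · rw [det_nonsing_inv]; exact hP.ringInverse
  · have hi : P * P⁻¹ = 1 := Matrix.mul_nonsing_inv P hP
    have hit : (P⁻¹)ᵀ * Pᵀ = 1 := by rw [← transpose_mul, hi, transpose_one]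
    calc P⁻¹ᵀ * (Pᵀ * B * P) * P⁻¹ = (P⁻¹ᵀ * Pᵀ) * B * (P * P⁻¹) := by noncomm_ring
      _ = B := by rw [hi, hit]; simp

theorem mcong_of_eq {B C P : Matrix ι ι F} (hC : C.det ≠ 0) (h : Pᵀ * B * P = C) : MCong B C := by
  refine ⟨P, ?_, h⟩
  rw [isUnit_iff_ne_zero]
  intro h0
  apply hC
  rw [← h, det_mul, h0, mul_zero]

theorem exists_repr [Fintype F] (h2 : ringChar F ≠ 2) (a b : F) (ha : a ≠ 0) (hb : b ≠ 0) :
    ∃ x y : F, a * x ^ 2 + b * y ^ 2 = 1 := by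
  open Polynomial in
  obtain ⟨x, y, h⟩ := FiniteField.exists_root_sum_quadratic (R := F)
    (f := C a * X ^ 2) (g := C b * X ^ 2 - C 1) (by rw [degree_C_mul_X_pow 2 ha]; rfl)
    (by rw [degree_sub_C (by rw [degree_C_mul_X_pow 2 hb]; norm_num), degree_C_mul_X_pow 2 hb]; rfl)
    (FiniteField.odd_card_of_char_ne_two h2)
  refine ⟨x, y, ?_⟩
  simp at h
  linear_combination h

theorem diag_step [Fintype F] (h2 : ringChar F ≠ 2) (w : ι → F) (hw : ∀ i, w i ≠ 0) (i j : ι)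
    (hij : i ≠ j) :
    MCong (diagonal w) (diagonal (Function.update (Function.update w i (w i * w j)) j 1)) := by
  obtain ⟨x, y, h⟩ := exists_repr h2 (w i) (w j) (hw i) (hw j)
  apply mcong_of_eq (P := ((1 : Matrix ι ι F).updateCol i
    (Pi.single i (- w j * y) + Pi.single j (w i * x))).updateCol j
    (Pi.single i x + Pi.single j y))
  · rw [det_diagonal, Finset.prod_ne_zero_iff]
    intro a _
    by_cases haj : a = j
    · subst haj; simp
    · by_cases hai : a = i
      · subst hai; simp [haj, hw]
      · simp [haj, hai, hw]
  · set P := ((1 : Matrix ι ι F).updateCol i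
      (Pi.single i (- w j * y) + Pi.single j (w i * x))).updateCol j
      (Pi.single i x + Pi.single j y) with hP
    have key : ∀ a b, (Pᵀ * diagonal w * P) a b = (P.col a) ⬝ᵥ (fun t => w t * P.col b t) := by
      intro a b
      rw [mul_assoc, mul_apply]
      simp [dotProduct, diagonal_mul]
    have cj : P.col j = Pi.single i x + Pi.single j y := by ext t; simp [hP]
    have ci : P.col i = Pi.single i (- w j * y) + Pi.single j (w i * x) := by
      ext t; simp [hP, updateCol_apply, hij]
    have co : ∀ a, a ≠ i → a ≠ j → P.col a = Pi.single a 1 := by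
      intro a h1 h2
      ext t; simp [hP, updateCol_apply, h1, h2, one_apply, Pi.single_apply]
    ext a b
    rw [key]
    have hji := hij.symm
    by_cases haj : a = j
    · subst haj
      by_cases hbj : b = a
      · subst hbj; rw [cj]; simp [hij, hji, add_dotProduct, single_dotProduct]
        linear_combination h
      by_cases hbi : b = i
      · subst hbi; rw [cj, ci]; simp [hij, hji, add_dotProduct, single_dotProduct]
        ring
      · rw [cj, co b hbi hbj]; simp [hij, hji, Ne.symm hbj, Ne.symm hbi, add_dotProduct, single_dotProduct]
    by_cases hai : a = i
    · subst hai
      by_cases hbj : b = j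
      · subst hbj; rw [cj, ci]; simp [hij, hji, add_dotProduct, single_dotProduct]
        ring
      by_cases hbi : b = a
      · subst hbi; rw [ci]; simp [hij, hji, add_dotProduct, single_dotProduct]
        linear_combination (w b * w j) * h
      · rw [ci, co b hbi hbj]; simp [hij, hji, Ne.symm hbj, Ne.symm hbi, add_dotProduct, single_dotProduct]
    · rw [co a hai haj, single_dotProduct]
      by_cases hbj : b = j
      · subst hbj; rw [cj]; simp [hij, hji, haj, hai]
      by_cases hbi : b = i
      · subst hbi; rw [ci]; simp [hij, hji, haj, hai]
      · rw [co b hbi hbj]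
        by_cases hab : a = b
        · subst hab; simp [haj, hai]
        · simp [hab]

theorem diag_norm [Fintype F] (h2 : ringChar F ≠ 2) (i : ι) (s : Finset ι) (hs : i ∉ s) :
    ∀ w : ι → F, (∀ i, w i ≠ 0) → (∀ j, j ≠ i → j ∉ s → w j = 1) → ∃ d, d ≠ 0 ∧ 
    MCong (diagonal w) (diagonal (Function.update 1 i d)) := by
  induction s using Finset.induction_on with
  | empty =>
    intro w hw h1
    refine ⟨w i, hw i, ?_⟩
    have : w = Function.update (1 : ι → F) i (w i) := by
      ext j
      by_cases hj : j = i
      · subst hj; simp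
      · simp [hj, h1 j hj]
    rw [← this]
    exact MCong.refl _
  | insert j s hj ih =>
    intro w hw h1
    simp only [Finset.mem_insert, not_or] at hs h1
    have hst := diag_step h2 w hw i j hs.1
    obtain ⟨d, hd, hd'⟩ := ih hs.2 (Function.update (Function.update w i (w i * w j)) j 1)
      (by
        intro a
        by_cases haj : a = j
        · subst haj; simp
        · by_cases hai : a = i
          · subst hai; simp [haj, hw]
          · simp [haj, hai, hw])
      (by
        intro a hai has
        by_cases haj : a = j
        · subst haj; simp
        · simp [haj, hai, h1 a hai ⟨haj, has⟩])
    exact ⟨d, hd, hst.trans hd'⟩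

theorem diagonalize (h2 : (2 : F) ≠ 0) {n : ℕ} (B : Matrix (Fin n) (Fin n) F) (hB : B.IsSymm) 
    (hdet : B.det ≠ 0) : ∃ w : Fin n → F, (∀ i, w i ≠ 0) ∧ MCong B (diagonal w) := by
  have : Invertible (2 : F) := invertibleOfNonzero h2
  let b := Pi.basisFun F (Fin n)
  let β : LinearMap.BilinForm F (Fin n → F) := Matrix.toBilin b B
  have hβ : LinearMap.IsSymm β := by
    constructor
    intro x y
    simp only [β, b, Matrix.toBilin_apply, RingHom.id_apply]
    rw [Finset.sum_comm]
    refine Finset.sum_congr rfl fun i _ => Finset.sum_congr rfl fun j _ => ?_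
    rw [hB.apply]; ring
  obtain ⟨v', hv'⟩ := LinearMap.BilinForm.exists_orthogonal_basis hβ
  have hfr : Module.finrank F (Fin n → F) = n := by simp
  let v := v'.reindex (finCongr hfr)
  have hv : ∀ i j, i ≠ j → β (v i) (v j) = 0 := by
    intro i j hij
    simp only [v, Module.Basis.reindex_apply]
    exact hv' (by simpa using hij)
  have h1 := LinearMap.BilinForm.toMatrix_mul_basis_toMatrix b v β
  have h3 : LinearMap.BilinForm.toMatrix b β = B := by simp [β]
  have h4 : LinearMap.BilinForm.toMatrix v β = diagonal (fun i => β (v i) (v i)) := by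
    ext i j
    rw [LinearMap.BilinForm.toMatrix_apply]
    by_cases hij : i = j
    · subst hij; simp
    · rw [hv i j hij, diagonal_apply_ne _ hij]
  rw [h3, h4] at h1
  have hu : IsUnit (b.toMatrix v).det := by
    have := b.toMatrix_mul_toMatrix_flip v
    apply IsUnit.of_mul_eq_one (v.toMatrix b).det
    rw [← det_mul, this, det_one]
  refine ⟨fun i => β (v i) (v i), ?_, _, hu, h1⟩
  have h5 := congrArg det h1
  rw [det_mul, det_mul, det_transpose, det_diagonal] at h5
  have h6 : ∏ i, β (v i) (v i) ≠ 0 := by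
    rw [← h5]
    exact mul_ne_zero (mul_ne_zero hu.ne_zero hdet) hu.ne_zero
  intro i
  exact Finset.prod_ne_zero_iff.mp h6 i (Finset.mem_univ i)

theorem classify [Fintype F] (h2 : ringChar F ≠ 2) {n : ℕ} (hn : 0 < n)
    (B C : Matrix (Fin n) (Fin n) F) (hB : B.IsSymm) (hC : C.IsSymm)
    (hBd : B.det ≠ 0) (hCd : C.det ≠ 0) (hsq : IsSquare B.det ↔ IsSquare C.det) : MCong B C := by
  have key : ∀ B : Matrix (Fin n) (Fin n) F, B.IsSymm → B.det ≠ 0 → ∃ d, d ≠ 0 ∧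
      MCong B (diagonal (Function.update 1 ⟨0, hn⟩ d)) ∧ (IsSquare B.det ↔ IsSquare d) := by
    intro B hB hBd
    obtain ⟨w, hw, hBw⟩ := diagonalize (Ring.two_ne_zero h2) B hB hBd
    obtain ⟨d, hd, hwd⟩ := diag_norm h2 (⟨0, hn⟩ : Fin n) (Finset.univ.erase ⟨0, hn⟩) (by simp) w hw
      (by intro j hj hj'; simp [hj] at hj')
    have h := hBw.trans hwd
    refine ⟨d, hd, h, ?_⟩
    obtain ⟨P, hP, hPB⟩ := h
    have := congrArg det hPB
    rw [det_mul, det_mul, det_transpose, det_diagonal, Finset.prod_update_of_mem (by simp)] at this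
    simp at this
    rw [← this]
    have hP0 := hP.ne_zero
    constructor
    · rintro ⟨r, hr⟩
      exact ⟨P.det * r, by rw [hr]; ring⟩
    · rintro ⟨r, hr⟩
      exact ⟨r / P.det, by field_simp; linear_combination hr⟩
  obtain ⟨d, hd, h1, h3⟩ := key B hB hBd
  obtain ⟨c, hc, h4, h5⟩ := key C hC hCd
  refine h1.trans (MCong.trans ?_ h4.symm)
  have hdc : IsSquare d ↔ IsSquare c := by rw [← h3, hsq, h5]
  have hq : ∃ r, c = d * (r * r) := by
    by_cases h : IsSquare d
    · obtain ⟨r, hr⟩ := h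
      obtain ⟨t, ht⟩ := hdc.mp ⟨r, hr⟩
      have : r ≠ 0 := by rintro rfl; simp at hr; exact hd hr
      exact ⟨t / r, by rw [hr, ht]; field_simp⟩
    · have hm : IsSquare (c * d) := by
        rw [FiniteField.isSquare_iff h2 (mul_ne_zero hc hd), mul_pow]
        have h' : ¬ IsSquare c := by rwa [← hdc]
        rw [FiniteField.isSquare_iff h2 hd] at h
        rw [FiniteField.isSquare_iff h2 hc] at h'
        rw [(FiniteField.pow_dichotomy h2 hd).resolve_left h,
          (FiniteField.pow_dichotomy h2 hc).resolve_left h']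
        ring
      obtain ⟨r, hr⟩ := hm
      exact ⟨r / d, by field_simp; linear_combination hr⟩
  obtain ⟨r, hr⟩ := hq
  have hr0 : r ≠ 0 := by rintro rfl; simp at hr; exact hc hr
  refine ⟨diagonal (Function.update 1 ⟨0, hn⟩ r), ?_, ?_⟩
  · rw [det_diagonal, Finset.prod_update_of_mem (by simp)]
    simpa using hr0
  · rw [diagonal_transpose, diagonal_mul_diagonal, diagonal_mul_diagonal]
    congr 1
    ext j
    by_cases hj : j = ⟨0, hn⟩
    · subst hj; simp [hr]; ring
    · simp [hj]
end classify
section construct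

theorem exists_zeta (p m N : ℕ) [Fact p.Prime] (hm : m ≠ 0) (hN : N ∣ p ^ m - 1) :
    ∃ z : GaloisField p m, orderOf z = N := by
  have : Finite (GaloisField p m) := inferInstance
  have : Fintype (GaloisField p m) := Fintype.ofFinite _
  obtain ⟨g, hg⟩ := IsCyclic.exists_ofOrder_eq_natCard (α := (GaloisField p m)ˣ)
  rw [Nat.card_units, GaloisField.card p m hm] at hg
  obtain ⟨c, hc⟩ := hN
  have h1 : 1 < p ^ m := Nat.one_lt_pow hm (Fact.out : p.Prime).one_lt
  have hc0 : c ≠ 0 := by rintro rfl; omega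
  refine ⟨((g ^ c : (GaloisField p m)ˣ) : GaloisField p m), ?_⟩
  rw [orderOf_units, orderOf_pow_of_dvd hc0 (by rw [hg, hc]; exact dvd_mul_left _ _), hg, hc,
    Nat.mul_div_cancel _ (Nat.pos_of_ne_zero hc0)]

theorem zeta_props {K : Type*} [Field K] (q l : ℕ) (hq : q.Prime) (hl : 1 ≤ l) (z : K)
    (hz : orderOf z = q ^ l) : z ^ q ^ l = 1 ∧ z ^ q ^ (l - 1) - 1 ≠ 0 := by
  refine ⟨hz ▸ pow_orderOf_eq_one z, fun h => ?_⟩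
  have h1 := orderOf_dvd_of_pow_eq_one (sub_eq_zero.mp h)
  rw [hz, Nat.pow_dvd_pow_iff_le_right hq.one_lt] at h1
  omega

theorem hyperbolic (p q l e : ℕ) [Fact p.Prime] (hq : q.Prime) (hl : 1 ≤ l) (he : e ≠ 0)
    (hd : q ^ l ∣ p ^ e - 1) : ∃ B : Matrix (Fin e ⊕ Fin e) (Fin e ⊕ Fin e) (ZMod p),
      B.IsSymm ∧ B.det = (-1) ^ e ∧ Good q l B := by
  obtain ⟨z, hz⟩ := exists_zeta p e (q ^ l) he hd
  obtain ⟨h1, h2⟩ := zeta_props q l hq hl z hz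
  let b : Module.Basis (Fin e) (ZMod p) (GaloisField p e) :=
    (Module.finBasis (ZMod p) (GaloisField p e)).reindex (finCongr (GaloisField.finrank p he))
  have hzu : z ≠ 0 := by
    rintro rfl
    rw [zero_pow (pow_ne_zero _ hq.ne_zero)] at h1
    exact zero_ne_one h1
  set M := Algebra.leftMulMatrix b z
  set M' := Algebra.leftMulMatrix b z⁻¹
  have hMM : M * M' = 1 := by rw [← map_mul, mul_inv_cancel₀ hzu, map_one]
  have hMM' : M' * M = 1 := by rw [← map_mul, inv_mul_cancel₀ hzu, map_one]
  have h3 : ∀ y : GaloisField p e, y ≠ 0 → IsUnit (Algebra.leftMulMatrix b y).det := by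
    intro y hy
    rw [← Matrix.isUnit_iff_isUnit_det]
    exact (isUnit_iff_ne_zero.mpr hy).map _
  refine ⟨fromBlocks 0 1 1 0, ?_, ?_, ?_⟩
  · rw [Matrix.IsSymm, fromBlocks_transpose]; simp
  · have : (fromBlocks 0 1 1 0 : Matrix (Fin e ⊕ Fin e) (Fin e ⊕ Fin e) (ZMod p)) *
      (fromBlocks 1 0 1 1) = fromBlocks 1 1 1 0 := by rw [fromBlocks_multiply]; simp
    have h := congrArg det this
    rw [det_mul, det_fromBlocks_zero₁₂, det_fromBlocks_one₁₁] at h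
    simpa [det_neg] using h
  · have hpow : ∀ (X Y : Matrix (Fin e) (Fin e) (ZMod p)) (m : ℕ),
        (fromBlocks X 0 0 Y) ^ m = fromBlocks (X ^ m) 0 0 (Y ^ m) := by
      intro X Y m
      induction m with
      | zero => simp
      | succ m ih => rw [pow_succ, ih, fromBlocks_multiply]; simp [pow_succ]
    refine ⟨fromBlocks M 0 0 M'ᵀ, ?_, ?_, ?_⟩
    · rw [fromBlocks_transpose, fromBlocks_multiply, fromBlocks_multiply]
      simp [← transpose_mul, hMM']
    · rw [hpow, ← transpose_pow, ← map_pow, ← map_pow, inv_pow, h1]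
      simp
    · rw [hpow, ← fromBlocks_one, sub_eq_add_neg, fromBlocks_neg, fromBlocks_add, neg_zero,
        add_zero, ← sub_eq_add_neg, ← sub_eq_add_neg, det_fromBlocks_zero₁₂,
        ← transpose_pow, ← transpose_one, ← transpose_sub, det_transpose, transpose_one,
        ← map_pow, ← map_pow, ← map_one (Algebra.leftMulMatrix b), ← map_sub, ← map_sub]
      refine (h3 _ h2).mul (h3 _ ?_)
      intro h
      apply h2
      rw [inv_pow, sub_eq_zero, inv_eq_one] at h
      rw [h, sub_self]

theorem finRotate_val (n : ℕ) (t : Fin n) :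
    ((finRotate n t : Fin n) : ℕ) = if (t : ℕ) + 1 = n then 0 else (t : ℕ) + 1 := by
  cases n with
  | zero => exact t.elim0
  | succ n =>
    rw [coe_finRotate]
    simp [Fin.ext_iff]

theorem anisotropic_aux (p q l e : ℕ) [Fact p.Prime] (hp2 : p ≠ 2) (hq : q.Prime) (hl : 1 ≤ l)
    (he : e ≠ 0)
    (hd : q ^ l ∣ p ^ e + 1) (K : Type) [Field K] [Fintype K] [Algebra (ZMod p) K]
    (hfr : Module.finrank (ZMod p) K = 2 * e) (hcard : Fintype.card K = p ^ (2 * e))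
    (z : K) (hz : orderOf z = q ^ l) :
    ∃ B : Matrix (Fin (2 * e)) (Fin (2 * e)) (ZMod p),
      B.IsSymm ∧ B.det ≠ 0 ∧ ¬ IsSquare ((-1) ^ e * B.det) ∧ Good q l B := by
  have he2 : 2 * e ≠ 0 := by omega
  have hp := (Fact.out : p.Prime)
  obtain ⟨h1, h2⟩ := zeta_props q l hq hl z hz
  have : CharP K p := charP_of_injective_algebraMap (algebraMap (ZMod p) K).injective p
  have hpc : ∀ x : K, x ^ p ^ (2 * e) = x := by
    intro x; rw [← hcard, FiniteField.pow_card]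
  let b : Module.Basis (Fin (2 * e)) (ZMod p) K :=
    (Module.finBasis (ZMod p) K).reindex (finCongr hfr)
  obtain ⟨φ, hφ⟩ : ∃ φ : K ≃ₐ[ZMod p] K, ∀ x, φ x = x ^ p ^ e := by
    have : ∀ m : ℕ, ∃ φ : K ≃ₐ[ZMod p] K, ∀ x, φ x = x ^ p ^ m := by
      intro m
      induction m with
      | zero => exact ⟨AlgEquiv.refl, fun x => by simp⟩
      | succ m ih =>
        obtain ⟨φ, hφ⟩ := ih
        refine ⟨φ.trans (FiniteField.frobeniusAlgEquivOfAlgebraic (ZMod p) K), fun x => ?_⟩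
        simp [hφ, ← pow_mul, pow_succ]
    exact this e
  have hφφ : ∀ x, φ (φ x) = x := by
    intro x
    rw [hφ, hφ, ← pow_mul, ← pow_add, ← two_mul, hpc]
  have htr : ∀ x, Algebra.trace (ZMod p) K (φ x) = Algebra.trace (ZMod p) K x := fun x =>
    Algebra.trace_eq_of_algEquiv φ x
  let β : LinearMap.BilinForm (ZMod p) K :=
    (Algebra.traceForm (ZMod p) K).comp LinearMap.id φ.toLinearMap
  have hβ : ∀ x y, β x y = Algebra.trace (ZMod p) K (x * φ y) := fun x y => rfl
  have hβs : ∀ x y, β x y = β y x := by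
    intro x y
    rw [hβ, hβ, ← htr, map_mul, hφφ, mul_comm]
  set B := LinearMap.BilinForm.toMatrix b β with hB
  have hBij : ∀ i j, B i j = Algebra.trace (ZMod p) K (b i * φ (b j)) := fun i j => by
    rw [hB, LinearMap.BilinForm.toMatrix_apply, hβ]
  have hBdet : B.det ≠ 0 := by
    rw [hB, ← LinearMap.BilinForm.nondegenerate_iff_det_ne_zero]
    have hL : ∀ x, (∀ y, β x y = 0) → x = 0 := by
      intro x hx
      apply (traceForm_nondegenerate (ZMod p) K).1 x
      intro y
      have := hx (φ y)
      rwa [hβ, hφφ] at this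
    exact ⟨hL, fun y hy => hL y fun x => by rw [hβs]; exact hy x⟩
  refine ⟨B, ?_, hBdet, ?_, ?_⟩
  · ext i j
    rw [transpose_apply, hB, LinearMap.BilinForm.toMatrix_apply,
      LinearMap.BilinForm.toMatrix_apply, hβs]
  · let M : Matrix (Fin (2 * e)) (Fin (2 * e)) K := Matrix.of fun i t => b i ^ p ^ (t : ℕ)
    have hrot : ∀ i t, M i (finRotate (2 * e) t) = M i t ^ p := by
      intro i t
      simp only [M, of_apply, ← pow_mul, ← pow_succ]
      have hv := finRotate_val (2 * e) t
      by_cases ht : (t : ℕ) + 1 = 2 * e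
      · rw [hv, if_pos ht, ht, hpc]; simp
      · rw [hv, if_neg ht]
    have hrotp : ∀ i t (j : ℕ), M i ((finRotate (2 * e) ^ j) t) = M i t ^ p ^ j := by
      intro i t j
      induction j with
      | zero => simp
      | succ j ih => rw [pow_succ', Equiv.Perm.mul_apply, hrot, ih, ← pow_mul, ← pow_succ]
    have hMp : M.det ^ p = - M.det := by
      have h := Matrix.det_permute' (finRotate (2 * e)) M
      have h' : M.submatrix id (finRotate (2 * e)) = (frobenius K p).mapMatrix M := by
        ext i t
        rw [submatrix_apply, id, hrot]
        rfl
      rw [h', ← RingHom.map_det, frobenius_def, sign_finRotate] at h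
      rw [h, Odd.neg_one_pow (by rw [Nat.odd_iff]; omega)]
      push_cast
      ring
    have hBM : B.map (algebraMap (ZMod p) K) = M * (M.submatrix id (finRotate (2 * e) ^ e))ᵀ := by
      ext i j
      rw [map_apply, hBij, FiniteField.algebraMap_trace_eq_sum_pow, mul_apply,
        hfr, Finset.sum_range, Nat.card_zmod]
      refine Finset.sum_congr rfl fun t _ => ?_
      rw [transpose_apply, submatrix_apply, id, hrotp, hφ, mul_pow]
      simp only [M, of_apply, ← pow_mul]
      rw [mul_comm (p ^ e)]
    have hdetB : algebraMap (ZMod p) K B.det = (-1) ^ e * M.det ^ 2 := by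
      rw [RingHom.map_det, RingHom.mapMatrix_apply, hBM, det_mul, det_transpose, det_permute',
        map_pow, sign_finRotate, Odd.neg_one_pow (by rw [Nat.odd_iff]; omega)]
      push_cast
      ring
    rintro ⟨r, hr⟩
    have hr' := congrArg (algebraMap (ZMod p) K) hr
    rw [map_mul, hdetB, map_mul, map_pow, map_neg, map_one, ← mul_assoc, ← mul_pow, neg_one_mul,
      neg_neg, one_pow, one_mul, ← sq] at hr'
    have hrp : (algebraMap (ZMod p) K r) ^ p = algebraMap (ZMod p) K r := by
      rw [← map_pow, ZMod.pow_card]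
    have hpo : Odd p := hp.odd_of_ne_two hp2
    have hfix : M.det ^ p = M.det := by
      rcases sq_eq_sq_iff_eq_or_eq_neg.mp hr' with h | h
      · rw [h, hrp]
      · rw [h, hpo.neg_pow, hrp]
    have h20 : (2 : K) ≠ 0 := by
      have : ringChar K ≠ 2 := by
        rw [ringChar.eq K p]; exact hp2
      exact Ring.two_ne_zero this
    have hM0 : M.det = 0 := by
      rw [hfix] at hMp
      have : 2 * M.det = 0 := by linear_combination hMp
      exact (mul_eq_zero.mp this).resolve_left h20
    apply hBdet
    apply (algebraMap (ZMod p) K).injective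
    rw [hdetB, hM0]; simp
  · have hz1 : z * φ z = 1 := by
      rw [hφ, ← pow_succ']
      exact orderOf_dvd_iff_pow_eq_one.mp (by rw [hz]; exact hd)
    refine ⟨Algebra.leftMulMatrix b z, ?_, ?_, ?_⟩
    · have : β.comp (LinearMap.mulLeft (ZMod p) z) (LinearMap.mulLeft (ZMod p) z) = β := by
        ext x y
        rw [LinearMap.BilinForm.comp_apply, hβ, hβ]
        congr 1
        simp only [LinearMap.mulLeft_apply, map_mul]
        linear_combination (x * φ y) * hz1
      have h := LinearMap.BilinForm.toMatrix_comp b b β (LinearMap.mulLeft (ZMod p) z)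
        (LinearMap.mulLeft (ZMod p) z)
      rw [this] at h
      exact h.symm
    · rw [← map_pow, h1, map_one]
    · rw [← map_pow, ← map_one (Algebra.leftMulMatrix b), ← map_sub,
        ← Matrix.isUnit_iff_isUnit_det]
      exact (isUnit_iff_ne_zero.mpr h2).map _

theorem anisotropic (p q l e : ℕ) [Fact p.Prime] (hp2 : p ≠ 2) (hq : q.Prime) (hl : 1 ≤ l)
    (he : e ≠ 0)
    (hd : q ^ l ∣ p ^ e + 1) : ∃ B : Matrix (Fin (2 * e)) (Fin (2 * e)) (ZMod p),
      B.IsSymm ∧ B.det ≠ 0 ∧ ¬ IsSquare ((-1) ^ e * B.det) ∧ Good q l B := by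
  have he2 : 2 * e ≠ 0 := by omega
  have hp := (Fact.out : p.Prime)
  have hd' : q ^ l ∣ p ^ (2 * e) - 1 := by
    have : p ^ (2 * e) - 1 = (p ^ e + 1) * (p ^ e - 1) := by
      rw [mul_comm 2 e, pow_mul, ← Nat.sq_sub_sq, one_pow]
    rw [this]
    exact Dvd.dvd.mul_right hd _
  obtain ⟨z, hz⟩ := exists_zeta p (2 * e) (q ^ l) he2 hd'
  have : Fintype (GaloisField p (2 * e)) := Fintype.ofFinite _
  exact anisotropic_aux p q l e hp2 hq hl he hd (GaloisField p (2 * e))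
    (GaloisField.finrank p he2)
    (by rw [← Nat.card_eq_fintype_card, GaloisField.card p _ he2]) z hz

end construct

theorem nonsq_mul {F : Type*} [Field F] [Fintype F] (h2 : ringChar F ≠ 2) {c d : F}
    (hc : ¬ IsSquare c) (hd : ¬ IsSquare d) : IsSquare (c * d) := by
  have hc0 : c ≠ 0 := by rintro rfl; exact hc IsSquare.zero
  have hd0 : d ≠ 0 := by rintro rfl; exact hd IsSquare.zero
  rw [FiniteField.isSquare_iff h2 (mul_ne_zero hc0 hd0), mul_pow]
  rw [FiniteField.isSquare_iff h2 hd0] at hd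
  rw [FiniteField.isSquare_iff h2 hc0] at hc
  rw [(FiniteField.pow_dichotomy h2 hd0).resolve_left hd,
    (FiniteField.pow_dichotomy h2 hc0).resolve_left hc]
  ring

theorem neg_one_pow_sq (p e : ℕ) [Fact p.Prime] :
    IsSquare ((-1) ^ e : ZMod p) ↔ ¬ (p % 4 = 3 ∧ (2 * e) % 4 = 2) := by
  rcases Nat.even_or_odd e with he | he
  · rw [he.neg_one_pow]
    have : ¬ (2 * e) % 4 = 2 := by obtain ⟨m, rfl⟩ := he; omega
    simp [this]
  · rw [he.neg_one_pow, ZMod.exists_sq_eq_neg_one_iff]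
    have : (2 * e) % 4 = 2 := by obtain ⟨m, rfl⟩ := he; omega
    simp [this]

theorem minExp_mem (p q : ℕ) (hp : p.Prime) (hq : q.Prime) (hpq : p ≠ q) :
    0 < minExp p q ∧ (q ∣ p ^ minExp p q - 1 ∨ q ∣ p ^ minExp p q + 1) := by
  have hne : {a : ℕ | 0 < a ∧ (q ∣ p ^ a - 1 ∨ q ∣ p ^ a + 1)}.Nonempty := by
    refine ⟨q - 1, Nat.sub_pos_of_lt hq.one_lt, Or.inl ?_⟩
    have h := Nat.ModEq.pow_totient ((Nat.coprime_primes hp hq).mpr hpq)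
    rw [Nat.totient_prime hq] at h
    exact (Nat.modEq_iff_dvd' (Nat.one_le_pow _ _ hp.pos)).mp h.symm
  exact Nat.sInf_mem hne

theorem stmt19 (p q : ℕ) (hp : p.Prime) (hq : q.Prime) (hp2 : p ≠ 2) (hq2 : q ≠ 2)
    (hpq : p ≠ q) (k : ℕ) (hk : 1 ≤ k)
    (s : ℕ) (hs : q ^ s ∣ p ^ (2 * minExp p q) - 1)
    (hs' : ¬ q ^ (s + 1) ∣ p ^ (2 * minExp p q) - 1)
    (n : ℕ) (hn : n = 2 * minExp p q)
    (B : Matrix (Fin n) (Fin n) (ZMod (p ^ k))) (hsymm : B.IsSymm) (hdet : IsUnit B.det)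
    (heps : epsilon p B = eta p q) :
    ∀ ℓ : ℕ, 1 ≤ ℓ → ℓ ≤ s →
      ∃ A : Matrix (Fin n) (Fin n) (ZMod (p ^ k)), Aᵀ * B * A = B ∧ orderOf A = q ^ ℓ ∧
        ∀ x : Fin n → ZMod (p ^ k), A.mulVec x = x → x = 0 := by
  intro l hl hls
  have : Fact p.Prime := ⟨hp⟩
  obtain ⟨he, hmem⟩ := minExp_mem p q hp hq hpq
  have hql : q ^ l ∣ p ^ (2 * minExp p q) - 1 := (pow_dvd_pow q hls).trans hs
  have heta : eta p q = if q ∣ p ^ minExp p q - 1 then 1 else -1 := rfl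
  rw [heta] at heps
  clear heta
  generalize minExp p q = e at *
  subst hn
  have : Nontrivial (ZMod (p ^ k)) := ZMod.nontrivial_iff.mpr
    (Nat.one_lt_pow (by omega) hp.one_lt).ne'
  have : Nonempty (Fin (2 * e)) := ⟨⟨0, by omega⟩⟩
  have hchar : ringChar (ZMod p) ≠ 2 := by rw [ZMod.ringChar_zmod_n]; exact hp2
  have hfac : p ^ (2 * e) - 1 = (p ^ e + 1) * (p ^ e - 1) := by
    rw [mul_comm 2 e, pow_mul, ← Nat.sq_sub_sq, one_pow]
  have hpe : 1 ≤ p ^ e := Nat.one_le_pow _ _ hp.pos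
  have hnot : ¬ (q ∣ p ^ e - 1 ∧ q ∣ p ^ e + 1) := by
    rintro ⟨ha, hb⟩
    have h2 : q ∣ 2 := by
      have := Nat.dvd_sub hb ha
      rwa [show p ^ e + 1 - (p ^ e - 1) = 2 by omega] at this
    exact hq2 ((Nat.prime_dvd_prime_iff_eq hq Nat.prime_two).mp h2)
  apply Good.final hq hl
  apply Good.lift hp hp2 hk B hsymm hdet
  set B' := (redHom p k hk).mapMatrix B with hB'
  have hB's : B'.IsSymm := by
    change (B.map _)ᵀ = B.map _
    rw [← Matrix.transpose_map, hsymm.eq]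
  have hB'd : B'.det = redHom p k hk B.det := by rw [RingHom.map_det]
  have hB'0 : B'.det ≠ 0 := by rw [hB'd]; exact (hdet.map _).ne_zero
  have hsq : IsSquare B.det ↔ IsSquare B'.det := by
    rw [hB'd]; exact red_isSquare hp hp2 hk _ hdet
  have main : ∀ B₀ : Matrix (Fin (2 * e)) (Fin (2 * e)) (ZMod p), B₀.IsSymm → B₀.det ≠ 0 →
      Good q l B₀ → (IsSquare B₀.det ↔ IsSquare B.det) → Good q l B' := by
    intro B₀ h1 h2 h3 h4
    obtain ⟨P, hP, hPB⟩ := classify hchar (by omega) B₀ B' h1 hB's h2 hB'0 (h4.trans hsq)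
    exact h3.congr P hP hPB
  unfold epsilon at heps
  rw [Fintype.card_fin] at heps
  by_cases hc : q ∣ p ^ e - 1
  · rw [if_pos hc] at heps
    have hd : q ^ l ∣ p ^ e - 1 := by
      rw [hfac] at hql
      refine Nat.Coprime.dvd_of_dvd_mul_left ?_ hql
      exact Nat.Coprime.pow_left _ ((Nat.Prime.coprime_iff_not_dvd hq).mpr fun h => hnot ⟨hc, h⟩)
    obtain ⟨B₀, h1, h2, h3⟩ := hyperbolic p q l e hq hl (by omega) hd
    let σ : Fin e ⊕ Fin e ≃ Fin (2 * e) := finSumFinEquiv.trans (finCongr (two_mul e).symm)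
    apply main (Matrix.reindex σ σ B₀)
    · change (B₀.submatrix _ _)ᵀ = B₀.submatrix _ _
      rw [transpose_submatrix, h1.eq]
    · rw [det_reindex_self, h2]
      exact pow_ne_zero _ (neg_ne_zero.mpr one_ne_zero)
    · exact h3.reindex σ
    · rw [det_reindex_self, h2, neg_one_pow_sq]
      split_ifs at heps with h4 h5 h5 <;> simp_all
  · rw [if_neg hc] at heps
    have hd : q ^ l ∣ p ^ e + 1 := by
      rw [hfac] at hql
      refine Nat.Coprime.dvd_of_dvd_mul_right ?_ hql
      exact Nat.Coprime.pow_left _ ((Nat.Prime.coprime_iff_not_dvd hq).mpr hc)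
    obtain ⟨B₀, h1, h2, h3, h4⟩ := anisotropic p q l e hp2 hq hl (by omega) hd
    apply main B₀ h1 h2 h4
    have h5 : IsSquare B.det ↔ (p % 4 = 3 ∧ (2 * e) % 4 = 2) := by
      split_ifs at heps with h4 h5 h5 <;> simp_all
    rw [h5, ← not_iff_not, ← neg_one_pow_sq]
    constructor
    · intro h6
      by_contra h7
      exact h3 (nonsq_mul hchar h7 h6)
    · intro h6 h7
      exact h3 (h6.mul h7)
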